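/- Let m ≥ 2, n ≥ 1, N ≥ 0 an integer, p ∈ [1,∞], and let a ∈ S^{m−1}. Then sup over nonzero P ∈ P_{n,m} (restricted to S^{m−1}) of |δ^N(P)(a)| / ‖P‖_{L_p(S^{m−1})} equals (1/|S^{m−2}|_{m−2})^{1/p} times sup over nonzero Q ∈ P_{n,1} of |(Ge_{m/2−1})^N(Q)(1)| / ‖Q‖_{L_{p,(1−t²)^{(m−3)/2}}([−1,1])}, with the convention 1/∞ = 0 (so the factor is 1 when p = ∞). -/

import Mathlib

open MeasureTheory Filter Topology Polynomial ENNReal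

noncomputable section

/-- The Laplace operator `Δ = Σ_j ∂²/∂x_j²` on functions `ℝᵐ → ℂ`. -/
def lap {m : ℕ} (f : EuclideanSpace ℝ (Fin m) → ℂ) (x : EuclideanSpace ℝ (Fin m)) : ℂ :=
  ∑ j : Fin m, iteratedDeriv 2 (fun t : ℝ => f (x + t • EuclideanSpace.single j (1:ℝ))) 0

/-- The spherical Laplacian: `δ(f)(x) = Δ_y[f(y/|y|)](x)`.  Applied at points of the
unit sphere, its iterates give the iterated spherical Laplacian `δ^N`. -/
def sphLap {m : ℕ} (f : EuclideanSpace ℝ (Fin m) → ℂ) : EuclideanSpace ℝ (Fin m) → ℂ :=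
  lap (fun y => f (‖y‖⁻¹ • y))

/-- The Gegenbauer operator `Ge_λ(φ)(t) = (1-t²)φ''(t) - (2λ+1)tφ'(t)` on polynomials. -/
def gegenOp (l : ℝ) (Q : Polynomial ℂ) : Polynomial ℂ :=
  (1 - X ^ 2) * derivative (derivative Q) - C ((2 * l + 1 : ℝ) : ℂ) * X * derivative Q

/-- Evaluation of an `m`-variate polynomial on `ℝᵐ`. -/
def mvEval {m : ℕ} (P : MvPolynomial (Fin m) ℂ) (x : EuclideanSpace ℝ (Fin m)) : ℂ :=
  MvPolynomial.eval (fun j => (x j : ℂ)) P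


/-! ### Algebraic form of the spherical Laplacian -/

/-- Flat Laplacian on polynomials. -/
def pLap (m : ℕ) : MvPolynomial (Fin m) ℂ →ₗ[ℂ] MvPolynomial (Fin m) ℂ :=
  ∑ j : Fin m, (MvPolynomial.pderiv j).toLinearMap ∘ₗ (MvPolynomial.pderiv j).toLinearMap

/-- Euler operator. -/
def pEul (m : ℕ) : MvPolynomial (Fin m) ℂ →ₗ[ℂ] MvPolynomial (Fin m) ℂ :=
  ∑ j : Fin m, (LinearMap.mulLeft ℂ (MvPolynomial.X j)) ∘ₗ (MvPolynomial.pderiv j).toLinearMap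

/-- Spherical Laplacian on polynomials. -/
def pD (m : ℕ) : MvPolynomial (Fin m) ℂ →ₗ[ℂ] MvPolynomial (Fin m) ℂ :=
  pLap m - pEul m ∘ₗ pEul m - ((m : ℂ) - 2) • pEul m

lemma pLap_apply {m : ℕ} (P : MvPolynomial (Fin m) ℂ) :
    pLap m P = ∑ j, MvPolynomial.pderiv j (MvPolynomial.pderiv j P) := by
  simp [pLap]

lemma pEul_apply {m : ℕ} (P : MvPolynomial (Fin m) ℂ) :
    pEul m P = ∑ j, MvPolynomial.X j * MvPolynomial.pderiv j P := by
  simp [pEul]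

lemma pD_apply {m : ℕ} (P : MvPolynomial (Fin m) ℂ) :
    pD m P = pLap m P - pEul m (pEul m P) - ((m : ℂ) - 2) • pEul m P := by
  simp [pD]

lemma pderiv_aeval_chain {m k : ℕ} (u : Fin k → MvPolynomial (Fin m) ℂ)
    (P : MvPolynomial (Fin k) ℂ) (j : Fin m) :
    MvPolynomial.pderiv j (MvPolynomial.aeval u P) =
      ∑ i, MvPolynomial.aeval u (MvPolynomial.pderiv i P) * MvPolynomial.pderiv j (u i) := by
  induction P using MvPolynomial.induction_on with
  | C c => simp [MvPolynomial.algebraMap_eq]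
  | add p q hp hq => simp only [map_add, hp, hq, add_mul, Finset.sum_add_distrib]
  | mul_X p i hp =>
    simp only [map_mul, MvPolynomial.aeval_X, Derivation.leibniz, hp, smul_eq_mul,
      MvPolynomial.pderiv_X, map_add, add_mul, Finset.sum_add_distrib, Finset.mul_sum]
    congr 1
    · rw [Finset.sum_eq_single i]
      · simp
      · intro b _ hb
        simp [Pi.single_apply, hb.symm]
      · simp
    · exact Finset.sum_congr rfl fun _ _ => by ring

lemma pderiv_paeval_chain {m : ℕ} (u : MvPolynomial (Fin m) ℂ)
    (Q : Polynomial ℂ) (j : Fin m) :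
    MvPolynomial.pderiv j (Polynomial.aeval u Q) =
      Polynomial.aeval u (derivative Q) * MvPolynomial.pderiv j u := by
  rw [Derivation.map_aeval, smul_eq_mul]

/-- The linear form `⟨x, v⟩`. -/
def lf {m : ℕ} (v : EuclideanSpace ℝ (Fin m)) : MvPolynomial (Fin m) ℂ :=
  ∑ j, MvPolynomial.C ((v j : ℝ) : ℂ) * MvPolynomial.X j

lemma pderiv_lf {m : ℕ} (v : EuclideanSpace ℝ (Fin m)) (j : Fin m) :
    MvPolynomial.pderiv j (lf v) = MvPolynomial.C ((v j : ℝ) : ℂ) := by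
  simp only [lf, map_sum, Derivation.leibniz, MvPolynomial.pderiv_C, MvPolynomial.pderiv_X,
    smul_eq_mul, mul_zero, add_zero]
  rw [Finset.sum_eq_single j]
  · simp
  · intro b _ hb
    simp [Pi.single_apply, hb]
  · simp

lemma mvEval_lf {m : ℕ} (v x : EuclideanSpace ℝ (Fin m)) :
    mvEval (lf v) x = ((inner ℝ x v : ℝ) : ℂ) := by
  simp [mvEval, lf, PiLp.inner_apply]

lemma pEul_zonal {m : ℕ} (v : EuclideanSpace ℝ (Fin m)) (Q : Polynomial ℂ) :
    pEul m (Polynomial.aeval (lf v) Q) = Polynomial.aeval (lf v) (X * derivative Q) := by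
  rw [pEul_apply]
  simp only [pderiv_paeval_chain, pderiv_lf, map_mul, Polynomial.aeval_X]
  conv_rhs => rw [lf, Finset.sum_mul]
  exact Finset.sum_congr rfl fun _ _ => by rw [← lf]; ring

lemma pLap_zonal {m : ℕ} (v : EuclideanSpace ℝ (Fin m)) (hv : ‖v‖ = 1) (Q : Polynomial ℂ) :
    pLap m (Polynomial.aeval (lf v) Q) = Polynomial.aeval (lf v) (derivative (derivative Q)) := by
  have h1 : ∑ j, MvPolynomial.C (σ := Fin m) ((v j : ℝ) : ℂ) * MvPolynomial.C ((v j : ℝ) : ℂ) = 1 := by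
    simp only [← map_mul, ← map_sum]
    have := EuclideanSpace.real_norm_sq_eq v
    rw [hv] at this
    have h1 : ((((1 : ℝ) ^ 2 : ℝ)) : ℂ) = 1 := by simp
    rw [← MvPolynomial.C_1, ← h1, this]
    congr 1
    push_cast
    exact Finset.sum_congr rfl fun _ _ => by ring
  rw [pLap_apply]
  simp only [pderiv_paeval_chain, pderiv_lf, Derivation.leibniz, MvPolynomial.pderiv_C,
    smul_eq_mul, mul_zero, zero_add]
  calc _ = Polynomial.aeval (lf v) (derivative (derivative Q)) *
      ∑ j, MvPolynomial.C (σ := Fin m) ((v j : ℝ) : ℂ) * MvPolynomial.C ((v j : ℝ) : ℂ) := by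
        rw [Finset.mul_sum]
        exact Finset.sum_congr rfl fun _ _ => by ring
    _ = _ := by rw [h1, mul_one]

lemma pD_zonal {m : ℕ} (v : EuclideanSpace ℝ (Fin m)) (hv : ‖v‖ = 1) (Q : Polynomial ℂ) :
    pD m (Polynomial.aeval (lf v) Q) = Polynomial.aeval (lf v) (gegenOp ((m : ℝ) / 2 - 1) Q) := by
  rw [pD_apply, pLap_zonal v hv, pEul_zonal, pEul_zonal, ← map_smul, ← map_sub, ← map_sub]
  congr 1
  simp only [gegenOp, derivative_mul, derivative_X, Polynomial.smul_eq_C_mul]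
  push_cast
  simp only [map_sub, map_add, map_mul, map_one]
  have : (C (2:ℂ)) * C ((m:ℂ) / 2) = C (m : ℂ) := by
    rw [← map_mul]; congr 1; ring
  linear_combination (X * derivative Q) * this

lemma pD_iter_zonal {m : ℕ} (v : EuclideanSpace ℝ (Fin m)) (hv : ‖v‖ = 1) (Q : Polynomial ℂ)
    (N : ℕ) : (pD m)^[N] (Polynomial.aeval (lf v) Q) =
      Polynomial.aeval (lf v) ((gegenOp ((m : ℝ) / 2 - 1))^[N] Q) := by
  induction N with
  | zero => rfl
  | succ N ih => rw [Function.iterate_succ_apply', Function.iterate_succ_apply', ih, pD_zonal v hv]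

/-- Composition of a polynomial with a linear isometry. -/
def pComp {m : ℕ} (g : EuclideanSpace ℝ (Fin m) ≃ₗᵢ[ℝ] EuclideanSpace ℝ (Fin m)) :
    MvPolynomial (Fin m) ℂ →ₐ[ℂ] MvPolynomial (Fin m) ℂ :=
  MvPolynomial.aeval fun i => lf (g.symm (EuclideanSpace.single i 1))

lemma mvEval_pComp {m : ℕ} (g : EuclideanSpace ℝ (Fin m) ≃ₗᵢ[ℝ] EuclideanSpace ℝ (Fin m))
    (P : MvPolynomial (Fin m) ℂ) (x : EuclideanSpace ℝ (Fin m)) :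
    mvEval (pComp g P) x = mvEval P (g x) := by
  have h : ∀ i, MvPolynomial.eval (fun j => ((x j : ℝ) : ℂ))
      (lf (g.symm (EuclideanSpace.single i 1))) = ((g x i : ℝ) : ℂ) := by
    intro i
    have := mvEval_lf (g.symm (EuclideanSpace.single i 1)) x
    rw [mvEval] at this
    rw [this, ← g.inner_map_map]
    simp [EuclideanSpace.inner_single_right]
  rw [mvEval, mvEval, pComp]
  induction P using MvPolynomial.induction_on with
  | C c => simp
  | add p q hp hq => simp only [map_add, hp, hq]
  | mul_X p i hp => simp only [map_mul, hp, MvPolynomial.aeval_X, h, MvPolynomial.eval_X]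

lemma lf_mul_sum {m : ℕ} (g : EuclideanSpace ℝ (Fin m) ≃ₗᵢ[ℝ] EuclideanSpace ℝ (Fin m))
    (i k : Fin m) :
    ∑ j, ((g.symm (EuclideanSpace.single i (1:ℝ)) j : ℝ) : ℂ) *
      ((g.symm (EuclideanSpace.single k (1:ℝ)) j : ℝ) : ℂ) = if i = k then 1 else 0 := by
  have : inner ℝ (g.symm (EuclideanSpace.single i (1:ℝ))) (g.symm (EuclideanSpace.single k (1:ℝ)))
    = if i = k then (1:ℝ) else 0 := by
    rw [g.symm.inner_map_map, EuclideanSpace.inner_single_right]; simp [Pi.single_apply, eq_comm]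
  rw [PiLp.inner_apply] at this
  have h2 := congrArg (fun r : ℝ => (r : ℂ)) this
  split_ifs at h2 ⊢ <;> (push_cast at h2; rw [← h2]; simp [mul_comm])

lemma pEul_pComp {m : ℕ} (g : EuclideanSpace ℝ (Fin m) ≃ₗᵢ[ℝ] EuclideanSpace ℝ (Fin m))
    (P : MvPolynomial (Fin m) ℂ) : pEul m (pComp g P) = pComp g (pEul m P) := by
  rw [pEul_apply, pEul_apply, pComp, map_sum]
  simp only [pderiv_aeval_chain, pderiv_lf, map_mul, MvPolynomial.aeval_X, Finset.mul_sum]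
  rw [Finset.sum_comm]
  refine Finset.sum_congr rfl fun i _ => ?_
  conv_rhs => rw [lf, Finset.sum_mul]
  exact Finset.sum_congr rfl fun j _ => by ring

lemma pLap_pComp {m : ℕ} (g : EuclideanSpace ℝ (Fin m) ≃ₗᵢ[ℝ] EuclideanSpace ℝ (Fin m))
    (P : MvPolynomial (Fin m) ℂ) : pLap m (pComp g P) = pComp g (pLap m P) := by
  rw [pLap_apply, pLap_apply, pComp, map_sum]
  simp only [pderiv_aeval_chain, pderiv_lf, map_sum, Derivation.leibniz, MvPolynomial.pderiv_C,
    smul_eq_mul, mul_zero, zero_add, Finset.mul_sum]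
  rw [Finset.sum_comm]
  refine Finset.sum_congr rfl fun i _ => ?_
  rw [Finset.sum_comm]
  rw [Finset.sum_eq_single i]
  · have := congrArg (MvPolynomial.C (σ := Fin m)) (lf_mul_sum g i i)
    simp only [if_true, map_sum, map_mul, map_one] at this
    conv_rhs => rw [← mul_one (MvPolynomial.aeval _ _), ← this, Finset.mul_sum]
    exact Finset.sum_congr rfl fun j _ => by ring
  · intro k _ hk
    have := congrArg (MvPolynomial.C (σ := Fin m)) (lf_mul_sum g i k)
    simp only [if_neg hk.symm, map_sum, map_mul, map_zero] at this
    rw [← mul_zero (MvPolynomial.aeval (fun i => lf (g.symm (EuclideanSpace.single i 1)))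
      (MvPolynomial.pderiv k (MvPolynomial.pderiv i P))), ← this, Finset.mul_sum]
    exact Finset.sum_congr rfl fun j _ => by ring
  · simp

lemma pD_pComp {m : ℕ} (g : EuclideanSpace ℝ (Fin m) ≃ₗᵢ[ℝ] EuclideanSpace ℝ (Fin m))
    (P : MvPolynomial (Fin m) ℂ) : pD m (pComp g P) = pComp g (pD m P) := by
  simp only [pD_apply, pLap_pComp, pEul_pComp, map_sub, map_smul]

lemma pD_iter_pComp {m : ℕ} (g : EuclideanSpace ℝ (Fin m) ≃ₗᵢ[ℝ] EuclideanSpace ℝ (Fin m))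
    (P : MvPolynomial (Fin m) ℂ) (N : ℕ) :
    (pD m)^[N] (pComp g P) = pComp g ((pD m)^[N] P) := by
  induction N with
  | zero => rfl
  | succ N ih => rw [Function.iterate_succ_apply', Function.iterate_succ_apply', ih, pD_pComp]

/-! ### Analytic part -/

lemma hasDerivAt_eval_curve {m : ℕ} (P : MvPolynomial (Fin m) ℂ) (z : ℝ → Fin m → ℂ)
    (z' : Fin m → ℂ) (t : ℝ) (hz : ∀ i, HasDerivAt (fun s => z s i) (z' i) t) :
    HasDerivAt (fun s => MvPolynomial.eval (z s) P)
      (∑ i, MvPolynomial.eval (z t) (MvPolynomial.pderiv i P) * z' i) t := by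
  induction P using MvPolynomial.induction_on with
  | C c => simpa using hasDerivAt_const t c
  | add p q hp hq =>
    simp only [map_add, add_mul, Finset.sum_add_distrib]
    exact hp.add hq
  | mul_X p i hp =>
    simp only [map_mul, MvPolynomial.eval_X, Derivation.leibniz, smul_eq_mul,
      MvPolynomial.pderiv_X, map_add, add_mul, Finset.sum_add_distrib]
    refine (hp.mul (hz i)).congr_deriv ?_
    symm
    rw [add_comm]
    congr 1
    · rw [Finset.sum_mul]
      exact Finset.sum_congr rfl fun _ _ => by ring
    · rw [Finset.sum_eq_single i]
      · simp
      · intro b _ hb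
        simp [Pi.single_apply, hb.symm]
      · simp

lemma norm_line_sq {m : ℕ} (x : EuclideanSpace ℝ (Fin m)) (hx : ‖x‖ = 1) (j : Fin m) (t : ℝ) :
    ‖x + t • EuclideanSpace.single j (1:ℝ)‖ ^ 2 = 1 + 2 * t * x j + t ^ 2 := by
  rw [norm_add_sq_real, hx, norm_smul, inner_smul_right, EuclideanSpace.inner_single_right]
  simp
  ring

lemma hasDerivAt_curve {m : ℕ} (x : EuclideanSpace ℝ (Fin m)) (hx : ‖x‖ = 1) (j : Fin m) :
    ∀ᶠ t : ℝ in 𝓝 0, 0 < 1 + 2 * t * x j + t ^ 2 := by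
  have : ContinuousAt (fun t : ℝ => 1 + 2 * t * x j + t ^ 2) 0 := by fun_prop
  exact this.eventually (lt_mem_nhds (by simp))

/-- derivative of the radial factor -/
lemma hasDerivAt_rad (c t : ℝ) (k : ℝ) (h : 0 < 1 + 2 * t * c + t ^ 2) :
    HasDerivAt (fun s : ℝ => (1 + 2 * s * c + s ^ 2) ^ (k))
      (2 * k * (c + t) * (1 + 2 * t * c + t ^ 2) ^ (k - 1)) t := by
  have h1 : HasDerivAt (fun s : ℝ => 1 + 2 * s * c + s ^ 2) (2 * c + 2 * t) t := by
    have := ((((hasDerivAt_id t).const_mul 2).mul_const c).const_add 1).add ((hasDerivAt_id t).pow 2)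
    refine this.congr_deriv ?_
    simp
  refine (h1.rpow_const (p := k) (Or.inl h.ne')).congr_deriv ?_
  ring

lemma second_deriv_line {m : ℕ} (P : MvPolynomial (Fin m) ℂ) (x : EuclideanSpace ℝ (Fin m))
    (hx : ‖x‖ = 1) (j : Fin m) :
    iteratedDeriv 2 (fun t : ℝ => mvEval P (‖x + t • EuclideanSpace.single j (1:ℝ)‖⁻¹ •
      (x + t • EuclideanSpace.single j (1:ℝ)))) 0 =
    ∑ i, ((∑ k, mvEval (MvPolynomial.pderiv k (MvPolynomial.pderiv i P)) x *
        ((if k = j then 1 else 0) - x j * x k)) * ((if i = j then 1 else 0) - x j * x i) +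
      mvEval (MvPolynomial.pderiv i P) x *
        ((3 * (x j) ^ 2 - 1) * x i - 2 * x j * (if i = j then 1 else 0))) := by
  let w : ℝ → ℝ := fun t => 1 + 2 * t * x j + t ^ 2
  let d : Fin m → ℝ := fun i => if i = j then 1 else 0
  let y : ℝ → Fin m → ℝ := fun t i => (w t) ^ (-(1/2) : ℝ) * (x i + t * d i)
  let y1 : ℝ → Fin m → ℝ := fun t i =>
    -(x j + t) * (w t) ^ (-(3/2) : ℝ) * (x i + t * d i) + (w t) ^ (-(1/2) : ℝ) * d i
  have hev := hasDerivAt_curve x hx j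
  have hlin : ∀ i t, HasDerivAt (fun s : ℝ => x i + s * d i) (d i) t := by
    intro i t
    simpa using ((hasDerivAt_id t).mul_const (d i)).const_add (x i)
  have hy : ∀ t, 0 < w t → ∀ i, HasDerivAt (fun s => y s i) (y1 t i) t := by
    intro t ht i
    refine ((hasDerivAt_rad (x j) t (-(1/2)) ht).mul (hlin i t)).congr_deriv ?_
    simp only [y1, w]
    rw [show (-(1/2) - 1 : ℝ) = -(3/2) by norm_num]
    ring
  have hy1 : ∀ i, HasDerivAt (fun s => y1 s i) ((3 * (x j) ^ 2 - 1) * x i - 2 * x j * d i) 0 := by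
    intro i
    have hr3 := hasDerivAt_rad (x j) 0 (-(3/2)) (by simp)
    have hr1 := hasDerivAt_rad (x j) 0 (-(1/2)) (by simp)
    have hl : HasDerivAt (fun s : ℝ => -(x j + s)) (-1) 0 :=
      ((hasDerivAt_id (0:ℝ)).const_add (x j)).neg
    refine (((hl.mul hr3).mul (hlin i 0)).add (hr1.mul_const (d i))).congr_deriv ?_
    simp
    ring
  have hfun : ∀ᶠ t in 𝓝 (0:ℝ), mvEval P (‖x + t • EuclideanSpace.single j (1:ℝ)‖⁻¹ •
      (x + t • EuclideanSpace.single j (1:ℝ))) =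
      MvPolynomial.eval (fun i => ((y t i : ℝ) : ℂ)) P := by
    filter_upwards [hev] with t ht
    rw [mvEval]
    congr 2
    funext i
    congr 1
    have : ‖x + t • EuclideanSpace.single j (1:ℝ)‖⁻¹ = (w t) ^ (-(1/2) : ℝ) := by
      have h2 := norm_line_sq x hx j t
      rw [Real.rpow_neg ht.le, ← Real.sqrt_eq_rpow]
      congr 1
      rw [← h2, Real.sqrt_sq (norm_nonneg _)]
    simp [y, this, d, Pi.single_apply, mul_add]
  have hyc : ∀ t, 0 < w t → ∀ i, HasDerivAt (fun s => ((y s i : ℝ) : ℂ)) ((y1 t i : ℝ) : ℂ) t :=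
    fun t ht i => (hy t ht i).ofReal_comp
  have hd1 : ∀ᶠ t in 𝓝 (0:ℝ), deriv (fun t : ℝ => mvEval P (‖x + t • EuclideanSpace.single j (1:ℝ)‖⁻¹ •
      (x + t • EuclideanSpace.single j (1:ℝ)))) t =
      ∑ i, MvPolynomial.eval (fun i => ((y t i : ℝ) : ℂ)) (MvPolynomial.pderiv i P) *
        ((y1 t i : ℝ) : ℂ) := by
    filter_upwards [hfun.eventually_nhds, hev] with t ht1 ht2
    rw [Filter.EventuallyEq.deriv_eq ht1]
    exact (hasDerivAt_eval_curve P _ _ t (hyc t ht2)).deriv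
  rw [iteratedDeriv_succ, iteratedDeriv_one, Filter.EventuallyEq.deriv_eq hd1]
  have h0 : 0 < w 0 := by simp [w]
  have hy0 : (fun i => ((y 0 i : ℝ) : ℂ)) = fun i => ((x i : ℝ) : ℂ) := by
    funext i; simp [y, w]
  have hy10 : ∀ i, ((y1 0 i : ℝ) : ℂ) = (if i = j then 1 else 0) - x j * x i := by
    intro i; simp [y1, w, d]; split_ifs <;> push_cast <;> ring
  have := HasDerivAt.fun_sum (u := Finset.univ) (fun i _ =>
    (hasDerivAt_eval_curve (MvPolynomial.pderiv i P) _ _ 0 (hyc 0 h0)).mul (hy1 i).ofReal_comp)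
  refine (HasDerivAt.deriv this).trans ?_
  simp only [hy0, hy10]
  refine Finset.sum_congr rfl fun i _ => ?_
  simp only [mvEval, d]
  congr 2
  push_cast
  split_ifs <;> simp

lemma sphLap_congr {m : ℕ} {f g : EuclideanSpace ℝ (Fin m) → ℂ}
    (h : ∀ x, ‖x‖ = 1 → f x = g x) (x : EuclideanSpace ℝ (Fin m)) (hx : ‖x‖ = 1) :
    sphLap f x = sphLap g x := by
  unfold sphLap lap
  refine Finset.sum_congr rfl fun j _ => ?_
  apply Filter.EventuallyEq.iteratedDeriv_eq
  filter_upwards [hasDerivAt_curve x hx j] with t ht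
  apply h
  rw [norm_smul, norm_inv, norm_norm, inv_mul_cancel₀]
  intro h0
  have := norm_line_sq x hx j t
  rw [h0] at this
  nlinarith

lemma sphLap_mvEval {m : ℕ} (P : MvPolynomial (Fin m) ℂ) (x : EuclideanSpace ℝ (Fin m))
    (hx : ‖x‖ = 1) : sphLap (mvEval P) x = mvEval (pD m P) x := by
  have hs : ∑ j, ((x j : ℝ) : ℂ) * x j = 1 := by
    have := EuclideanSpace.real_norm_sq_eq x
    rw [hx] at this
    have h2 := congrArg (fun r : ℝ => (r : ℂ)) this
    push_cast at h2
    rw [one_pow] at h2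
    rw [h2]
    exact Finset.sum_congr rfl fun _ _ => by ring
  have hk : ∀ k i : Fin m, ∑ j, ((if k = j then (1:ℂ) else 0) - x j * x k) *
      ((if i = j then 1 else 0) - x j * x i) = (if i = k then 1 else 0) - x i * x k := by
    intro k i
    calc _ = ∑ j, ((if k = j then (if i = j then (1:ℂ) else 0) else 0)
        - (if k = j then (x j : ℂ) * x i else 0) - (if i = j then (x j : ℂ) * x k else 0)
          + (x j * x j) * (x k * x i)) := by
          refine Finset.sum_congr rfl fun j _ => ?_
          split_ifs <;> ring
      _ = _ := by
          rw [Finset.sum_add_distrib, ← Finset.sum_mul, hs]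
          simp
          ring
  have h2 : ∀ i : Fin m, ∑ j, ((3 * ((x j : ℝ) : ℂ) ^ 2 - 1) * x i - 2 * x j *
      (if i = j then 1 else 0)) = (1 - (m : ℂ)) * x i := by
    intro i
    calc _ = ∑ j, ((x j * x j : ℂ) * (3 * x i) - x i - (if i = j then 2 * (x j : ℂ) else 0)) := by
          refine Finset.sum_congr rfl fun j _ => ?_
          split_ifs <;> ring
      _ = _ := by
          rw [Finset.sum_sub_distrib, Finset.sum_sub_distrib, ← Finset.sum_mul, hs]
          simp
          ring
  unfold sphLap lap
  simp only [second_deriv_line P x hx]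
  rw [Finset.sum_comm]
  simp only [Finset.sum_add_distrib]
  have hA : ∑ i, ∑ j, (∑ k, mvEval (MvPolynomial.pderiv k (MvPolynomial.pderiv i P)) x *
        ((if k = j then 1 else 0) - x j * x k)) * ((if i = j then 1 else 0) - x j * x i)
      = ∑ i, ∑ k, mvEval (MvPolynomial.pderiv k (MvPolynomial.pderiv i P)) x *
        ((if i = k then 1 else 0) - x i * x k) := by
    refine Finset.sum_congr rfl fun i _ => ?_
    simp only [Finset.sum_mul]
    rw [Finset.sum_comm]
    refine Finset.sum_congr rfl fun k _ => ?_
    rw [← hk, Finset.mul_sum]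
    exact Finset.sum_congr rfl fun j _ => by ring
  rw [hA]
  simp only [← Finset.mul_sum, h2]
  have hE : mvEval (pEul m P) x = ∑ i, mvEval (MvPolynomial.pderiv i P) x * x i := by
    rw [pEul_apply]
    simp only [mvEval, map_sum, map_mul, MvPolynomial.eval_X]
    exact Finset.sum_congr rfl fun _ _ => by ring
  have hEE : mvEval (pEul m (pEul m P)) x =
      ∑ i, ∑ k, mvEval (MvPolynomial.pderiv k (MvPolynomial.pderiv i P)) x * (x i * x k) +
      ∑ i, mvEval (MvPolynomial.pderiv i P) x * x i := by
    rw [pEul_apply]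
    simp only [pEul_apply, map_sum, Derivation.leibniz, smul_eq_mul, MvPolynomial.pderiv_X]
    simp only [mvEval, map_sum, map_add, map_mul, MvPolynomial.eval_X, Finset.mul_sum, mul_add]
    rw [Finset.sum_comm, ← Finset.sum_add_distrib]
    refine Finset.sum_congr rfl fun i _ => ?_
    rw [Finset.sum_add_distrib]
    congr 1
    · exact Finset.sum_congr rfl fun _ _ => by ring
    · rw [Finset.sum_eq_single i]
      · simp; ring
      · intro b _ hb
        simp [Pi.single_apply, hb.symm, hb]
      · simp
  have hL : mvEval (pLap m P) x = ∑ i, ∑ k,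
      mvEval (MvPolynomial.pderiv k (MvPolynomial.pderiv i P)) x * (if i = k then 1 else 0) := by
    rw [pLap_apply]
    simp [mvEval]
  have hD : mvEval (pD m P) x = mvEval (pLap m P) x - mvEval (pEul m (pEul m P)) x -
      ((m : ℂ) - 2) * mvEval (pEul m P) x := by
    rw [pD_apply]
    simp [mvEval]
  rw [hD, hE, hEE, hL]
  have h5 : ∑ i, mvEval (MvPolynomial.pderiv i P) x * ((1 - (m : ℂ)) * x i) =
      (1 - (m : ℂ)) * ∑ i, mvEval (MvPolynomial.pderiv i P) x * x i := by
    rw [Finset.mul_sum]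
    exact Finset.sum_congr rfl fun _ _ => by ring
  rw [h5]
  simp only [mul_sub, Finset.sum_sub_distrib]
  ring

lemma sphLap_iter_mvEval {m : ℕ} (P : MvPolynomial (Fin m) ℂ) (N : ℕ)
    (x : EuclideanSpace ℝ (Fin m)) (hx : ‖x‖ = 1) :
    (sphLap (m := m))^[N] (mvEval P) x = mvEval ((pD m)^[N] P) x := by
  induction N generalizing x with
  | zero => rfl
  | succ N ih =>
    rw [Function.iterate_succ_apply', Function.iterate_succ_apply', ← sphLap_mvEval _ x hx]
    exact sphLap_congr ih x hx


/-! ### Measure theory on the sphere -/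

open scoped Pointwise in
lemma toSphere_preimage {m : ℕ} (A : Set (EuclideanSpace ℝ (Fin m)))
    (s : Set (Metric.sphere (0 : EuclideanSpace ℝ (Fin m)) 1))
    (hA : ∀ x : Metric.sphere (0 : EuclideanSpace ℝ (Fin m)) 1, x ∈ s ↔ (x : EuclideanSpace ℝ (Fin m)) ∈ A) :
    Set.Ioo (0:ℝ) 1 • (((↑) : _ → EuclideanSpace ℝ (Fin m)) '' s) =
      {y | y ≠ 0 ∧ ‖y‖ < 1 ∧ ‖y‖⁻¹ • y ∈ A} := by
  ext y
  rw [Set.mem_smul]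
  constructor
  · rintro ⟨r, hr, _, ⟨x, hx, rfl⟩, rfl⟩
    have hx1 : ‖(x : EuclideanSpace ℝ (Fin m))‖ = 1 := by simp
    have hn : ‖r • (x : EuclideanSpace ℝ (Fin m))‖ = r := by
      rw [norm_smul, hx1, mul_one, Real.norm_of_nonneg hr.1.le]
    refine ⟨?_, ?_, ?_⟩
    · rw [← norm_ne_zero_iff, hn]; exact hr.1.ne'
    · rw [hn]; exact hr.2
    · rw [hn, smul_smul, inv_mul_cancel₀ hr.1.ne', one_smul]
      exact (hA x).1 hx
  · rintro ⟨h0, h1, h2⟩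
    have hn : ‖y‖ ≠ 0 := norm_ne_zero_iff.2 h0
    have hs : ‖‖y‖⁻¹ • y‖ = 1 := by
      rw [norm_smul, norm_inv, norm_norm, inv_mul_cancel₀ hn]
    refine ⟨‖y‖, ⟨norm_pos_iff.2 h0, h1⟩, ‖y‖⁻¹ • y, ⟨⟨‖y‖⁻¹ • y, by simp [hs]⟩, ?_, rfl⟩, ?_⟩
    · exact (hA _).2 h2
    · rw [smul_smul, mul_inv_cancel₀ hn, one_smul]

/-- The action of an isometry on the sphere. -/
def sphMap {m : ℕ} (g : EuclideanSpace ℝ (Fin m) ≃ₗᵢ[ℝ] EuclideanSpace ℝ (Fin m))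
    (x : Metric.sphere (0 : EuclideanSpace ℝ (Fin m)) 1) :
    Metric.sphere (0 : EuclideanSpace ℝ (Fin m)) 1 :=
  ⟨g x, by simp⟩

lemma measurePreserving_sphMap {m : ℕ}
    (g : EuclideanSpace ℝ (Fin m) ≃ₗᵢ[ℝ] EuclideanSpace ℝ (Fin m)) :
    MeasurePreserving (sphMap g) (volume : Measure (EuclideanSpace ℝ (Fin m))).toSphere
      (volume : Measure (EuclideanSpace ℝ (Fin m))).toSphere := by
  have hmeas : Measurable (sphMap g) := by
    apply Continuous.measurable
    exact Continuous.subtype_mk (g.continuous.comp continuous_subtype_val) _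
  refine ⟨hmeas, ?_⟩
  ext s hs
  rw [Measure.map_apply hmeas hs, Measure.toSphere_apply' _ hs,
    Measure.toSphere_apply' _ (hmeas hs)]
  congr 1
  rw [toSphere_preimage ((↑) '' s) s (by simp),
    toSphere_preimage (g ⁻¹' ((↑) '' s)) (sphMap g ⁻¹' s) ?_]
  · have := g.measurePreserving.measure_preimage_equiv (f := g.toMeasurableEquiv)
      {y | y ≠ 0 ∧ ‖y‖ < 1 ∧ ‖y‖⁻¹ • y ∈ ((↑) '' s : Set (EuclideanSpace ℝ (Fin m)))}
    rw [← this]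
    congr 1
    ext y
    simp
  · intro x
    have hg : (g x : EuclideanSpace ℝ (Fin m)) = (sphMap g x : EuclideanSpace ℝ (Fin m)) := rfl
    rw [Set.mem_preimage, Set.mem_preimage, hg]
    simp

/-- radial lintegral -/
lemma lintegral_radial {k : ℕ} (hk : 1 ≤ k) (h : ℝ → ℝ≥0∞) (hh : Measurable h) :
    ∫⁻ z : EuclideanSpace ℝ (Fin k), h ‖z‖ =
      (k * volume (Metric.ball (0 : EuclideanSpace ℝ (Fin k)) 1)) *
        ∫⁻ ρ in Set.Ioi (0:ℝ), ENNReal.ofReal (ρ ^ (k - 1)) * h ρ := by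
  have : Nonempty (Fin k) := ⟨⟨0, hk⟩⟩
  have : Nontrivial (EuclideanSpace ℝ (Fin k)) := inferInstance
  let μ : Measure (EuclideanSpace ℝ (Fin k)) := volume
  have h1 : ∫⁻ z, h ‖z‖ ∂μ = ∫⁻ x : ({(0)}ᶜ : Set (EuclideanSpace ℝ (Fin k))), h ‖x.1‖ ∂(μ.comap (↑)) := by
    rw [lintegral_subtype_comap (measurableSet_singleton _).compl fun x ↦ h (‖x‖),
        restrict_compl_singleton]
  have h2 : ∫⁻ x : ({(0)}ᶜ : Set (EuclideanSpace ℝ (Fin k))), h ‖x.1‖ ∂(μ.comap (↑)) =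
      ∫⁻ x, h x.2 ∂μ.toSphere.prod (.volumeIoiPow (k - 1)) := by
    have := μ.measurePreserving_homeomorphUnitSphereProd.lintegral_comp_emb
        (Homeomorph.measurableEmbedding _) (h ∘ Subtype.val ∘ Prod.snd)
    simpa using this
  have h3 : ∫⁻ x, h x.2 ∂μ.toSphere.prod (.volumeIoiPow (k - 1)) =
      μ.toSphere Set.univ * ∫⁻ x : Set.Ioi (0 : ℝ), h x ∂.volumeIoiPow (k - 1) := by
    have := lintegral_prod_mul (μ := μ.toSphere) (ν := .volumeIoiPow (k - 1)) (f := fun _ => 1)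
      (g := fun x : Set.Ioi (0:ℝ) => h x) (by fun_prop)
      (hh.comp measurable_subtype_coe).aemeasurable
    simpa using this
  rw [h1, h2, h3, Measure.toSphere_apply_univ]
  congr 1
  · simp [μ]
  · have h4 := lintegral_withDensity_eq_lintegral_mul (Measure.comap Subtype.val volume)
      (f := fun r : Set.Ioi (0:ℝ) => ENNReal.ofReal (r.1 ^ (k - 1))) (by fun_prop)
      (g := fun r : Set.Ioi (0:ℝ) => h r.1) (hh.comp measurable_subtype_coe)
    rw [Measure.volumeIoiPow, h4]
    exact lintegral_subtype_comap measurableSet_Ioi (fun ρ : ℝ => ENNReal.ofReal (ρ ^ (k - 1)) * h ρ)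

lemma cos_image_Ioo : Real.cos '' Set.Ioo 0 Real.pi = Set.Ioo (-1) 1 := by
  ext t
  constructor
  · rintro ⟨θ, ⟨h0, h1⟩, rfl⟩
    constructor
    · rw [← Real.cos_pi]
      exact Real.cos_lt_cos_of_nonneg_of_le_pi h0.le le_rfl h1
    · rw [← Real.cos_zero]
      exact Real.cos_lt_cos_of_nonneg_of_le_pi le_rfl h1.le h0
  · rintro ⟨h0, h1⟩
    exact ⟨Real.arccos t, ⟨Real.arccos_pos.2 h1, Real.arccos_lt_pi.2 h0⟩,
      Real.cos_arccos h0.le h1.le⟩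

lemma lintegral_cos (j : ℕ) (G : ℝ → ℝ≥0∞) :
    ∫⁻ θ in Set.Ioo 0 Real.pi, ENNReal.ofReal (Real.sin θ ^ j) * G (Real.cos θ) =
      ∫⁻ t in Set.Icc (-1:ℝ) 1, ENNReal.ofReal ((1 - t ^ 2) ^ (((j : ℝ) - 1) / 2)) * G t := by
  rw [← Measure.restrict_congr_set Ioo_ae_eq_Icc, ← cos_image_Ioo,
    lintegral_image_eq_lintegral_abs_deriv_mul measurableSet_Ioo
      (f' := fun θ => - Real.sin θ) (fun x _ => (Real.hasDerivAt_cos x).hasDerivWithinAt)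
      (Real.injOn_cos.mono Set.Ioo_subset_Icc_self)]
  refine setLIntegral_congr_fun measurableSet_Ioo fun θ hθ => ?_
  have hs : 0 < Real.sin θ := Real.sin_pos_of_pos_of_lt_pi hθ.1 hθ.2
  rw [← mul_assoc, ← ENNReal.ofReal_mul (abs_nonneg _), abs_neg, abs_of_pos hs]
  congr 2
  rw [← Real.sin_sq, ← Real.rpow_natCast, ← Real.rpow_natCast, ← Real.rpow_mul hs.le]
  have : Real.sin θ * Real.sin θ ^ (((2:ℕ):ℝ) * (((j:ℝ) - 1)/2)) =
    Real.sin θ ^ (1 + ((2:ℕ):ℝ) * (((j:ℝ) - 1)/2)) := by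
    rw [Real.rpow_add hs, Real.rpow_one]
  rw [this]
  congr 1
  push_cast
  ring

lemma lintegral_pow_Ioo (j : ℕ) :
    ∫⁻ r in Set.Ioo (0:ℝ) 1, ENNReal.ofReal (r ^ j) = ENNReal.ofReal (1 / ((j : ℝ) + 1)) := by
  rw [← ofReal_integral_eq_lintegral_ofReal]
  · rw [← integral_Ioc_eq_integral_Ioo, ← intervalIntegral.integral_of_le zero_le_one, integral_pow]
    simp
  · exact (Continuous.integrableOn_Icc (by fun_prop)).mono_set Set.Ioo_subset_Icc_self
  · filter_upwards [ae_restrict_mem measurableSet_Ioo] with r hr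
    exact pow_nonneg hr.1.le _

lemma polar_half (j : ℕ) (G : ℝ → ℝ≥0∞) (hG : Measurable G) :
    ∫⁻ s : ℝ, ∫⁻ ρ in Set.Ioi (0:ℝ), ENNReal.ofReal (ρ ^ j) *
      (if s ^ 2 + ρ ^ 2 < 1 then G (s / √(s ^ 2 + ρ ^ 2)) else 0) =
    ENNReal.ofReal (1 / ((j : ℝ) + 2)) *
      ∫⁻ t in Set.Icc (-1:ℝ) 1, ENNReal.ofReal ((1 - t ^ 2) ^ (((j : ℝ) - 1) / 2)) * G t := by
  let F : ℝ × ℝ → ℝ≥0∞ := fun p => if 0 < p.2 then ENNReal.ofReal (p.2 ^ j) *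
      (if p.1 ^ 2 + p.2 ^ 2 < 1 then G (p.1 / √(p.1 ^ 2 + p.2 ^ 2)) else 0) else 0
  have hF : Measurable F := by
    refine Measurable.ite (measurableSet_lt measurable_const measurable_snd) ?_ measurable_const
    refine Measurable.mul (by fun_prop) ?_
    refine Measurable.ite (measurableSet_lt (by fun_prop) measurable_const) ?_ measurable_const
    exact hG.comp (by fun_prop)
  have h1 : ∫⁻ s : ℝ, ∫⁻ ρ in Set.Ioi (0:ℝ), ENNReal.ofReal (ρ ^ j) *
      (if s ^ 2 + ρ ^ 2 < 1 then G (s / √(s ^ 2 + ρ ^ 2)) else 0) = ∫⁻ p : ℝ × ℝ, F p := by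
    rw [Measure.volume_eq_prod, lintegral_prod _ hF.aemeasurable]
    refine lintegral_congr fun s => ?_
    rw [← lintegral_indicator measurableSet_Ioi]
    refine lintegral_congr fun ρ => ?_
    simp only [Set.indicator, Set.mem_Ioi, F]
  rw [h1, ← lintegral_comp_polarCoord_symm, ← lintegral_cos]
  have h2 : ∫⁻ r in Set.Ioo (0:ℝ) 1, ENNReal.ofReal (r ^ (j + 1)) =
      ENNReal.ofReal (1 / ((j : ℝ) + 2)) := by
    rw [lintegral_pow_Ioo]; congr 2; push_cast; ring
  rw [← h2, ← lintegral_indicator measurableSet_Ioo, ← lintegral_indicator measurableSet_Ioo,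
    ← lintegral_prod_mul (Measurable.aemeasurable ?_) (Measurable.aemeasurable ?_),
    ← lintegral_indicator polarCoord.open_target.measurableSet]
  · refine lintegral_congr fun p => ?_
    obtain ⟨r, θ⟩ := p
    simp only [Set.indicator, polarCoord_target, polarCoord_symm_apply, Set.mem_prod, Set.mem_Ioi,
      Set.mem_Ioo, F, smul_eq_mul]
    by_cases hr : 0 < r
    swap
    · simp [hr]
    have hsq : (r * Real.cos θ) ^ 2 + (r * Real.sin θ) ^ 2 = r ^ 2 := by
      have := Real.sin_sq_add_cos_sq θ
      linear_combination r ^ 2 * this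
    rw [hsq, Real.sqrt_sq hr.le, mul_div_cancel_left₀ _ hr.ne']
    by_cases hθ : -Real.pi < θ ∧ θ < Real.pi
    swap
    · have : ¬ (0 < θ ∧ θ < Real.pi) := fun h => hθ ⟨by linarith [Real.pi_pos], h.2⟩
      simp [hθ, this]
    by_cases hθ0 : 0 < θ
    · have hs : 0 < Real.sin θ := Real.sin_pos_of_pos_of_lt_pi hθ0 hθ.2
      have hrs : 0 < r * Real.sin θ := mul_pos hr hs
      have : r ^ 2 < 1 ↔ r < 1 := by rw [sq_lt_one_iff₀ hr.le]
      simp only [hr, hθ, hθ0, hrs, this, and_self, true_and, if_true]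
      by_cases hr1 : r < 1
      · simp only [hr1, if_true]
        rw [← mul_assoc, ← mul_assoc, ← ENNReal.ofReal_mul hr.le,
          ← ENNReal.ofReal_mul (by positivity)]
        congr 2
        ring
      · simp [hr1]
    · have hs : ¬ 0 < r * Real.sin θ := by
        have : Real.sin θ ≤ 0 := Real.sin_nonpos_of_nonpos_of_neg_pi_le (by linarith) hθ.1.le
        nlinarith
      simp [hs, hθ0]
  · exact Measurable.indicator (by fun_prop) measurableSet_Ioo
  · exact Measurable.indicator (Measurable.mul (by fun_prop) (hG.comp Real.measurable_cos))
      measurableSet_Ioo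

/-- The split `ℝ^{k+1} → ℝ × ℝ^k`. -/
def spl {k : ℕ} (y : EuclideanSpace ℝ (Fin (k + 1))) : ℝ × EuclideanSpace ℝ (Fin k) :=
  (y 0, WithLp.toLp 2 fun i => y i.succ)

lemma measurePreserving_spl {k : ℕ} : MeasurePreserving (spl (k := k)) := by
  have h1 := PiLp.volume_preserving_ofLp (Fin (k + 1))
  have h2 := volume_preserving_piFinSuccAbove (fun _ : Fin (k + 1) => ℝ) 0
  have h3 := (MeasurePreserving.id (volume : Measure ℝ)).prod (PiLp.volume_preserving_toLp (Fin k))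
  exact h3.comp (h2.comp h1)

lemma norm_sq_spl {k : ℕ} (y : EuclideanSpace ℝ (Fin (k + 1))) :
    ‖y‖ ^ 2 = (spl y).1 ^ 2 + ‖(spl y).2‖ ^ 2 := by
  rw [EuclideanSpace.real_norm_sq_eq, EuclideanSpace.real_norm_sq_eq, Fin.sum_univ_succ]
  rfl

/-- Surface area of `S^{k-1}`. -/
lemma area_eq {k : ℕ} (hk : 1 ≤ k) :
    (k * volume (Metric.ball (0 : EuclideanSpace ℝ (Fin k)) 1)) =
      ENNReal.ofReal (2 * Real.pi ^ ((k : ℝ) / 2) / Real.Gamma ((k : ℝ) / 2)) := by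
  have : Nonempty (Fin k) := ⟨⟨0, hk⟩⟩
  have hk0 : (0:ℝ) < k := by exact_mod_cast hk
  have hG : 0 < Real.Gamma ((k : ℝ) / 2) := Real.Gamma_pos_of_pos (by positivity)
  rw [EuclideanSpace.volume_ball]
  simp only [Fintype.card_fin, ENNReal.ofReal_one, one_pow, one_mul]
  rw [← ENNReal.ofReal_natCast, ← ENNReal.ofReal_mul hk0.le]
  congr 1
  rw [Real.Gamma_add_one (by positivity), Real.sqrt_eq_rpow, ← Real.rpow_natCast,
    ← Real.rpow_mul Real.pi_pos.le, show (1/2 : ℝ) * k = k / 2 by ring]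
  field_simp

lemma volume_cone {k : ℕ} (hk : 1 ≤ k) (B : Set ℝ) (hB : MeasurableSet B) :
    volume {y : EuclideanSpace ℝ (Fin (k + 1)) | y ≠ 0 ∧ ‖y‖ < 1 ∧ y 0 / ‖y‖ ∈ B} =
      ENNReal.ofReal (2 * Real.pi ^ ((k : ℝ) / 2) / Real.Gamma ((k : ℝ) / 2)) *
      (ENNReal.ofReal (1 / ((k : ℝ) + 1)) *
      ∫⁻ t in Set.Icc (-1:ℝ) 1, ENNReal.ofReal ((1 - t ^ 2) ^ (((k : ℝ) - 2) / 2)) *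
        B.indicator 1 t) := by
  let S : Set (ℝ × EuclideanSpace ℝ (Fin k)) :=
    {p | p.1 ^ 2 + ‖p.2‖ ^ 2 < 1 ∧ p.1 / √(p.1 ^ 2 + ‖p.2‖ ^ 2) ∈ B}
  have hS : MeasurableSet S := by
    refine MeasurableSet.inter (measurableSet_lt
      (f := fun p : ℝ × EuclideanSpace ℝ (Fin k) => p.1 ^ 2 + ‖p.2‖ ^ 2) (by fun_prop)
      measurable_const) ?_
    exact measurableSet_preimage (f := fun p : ℝ × EuclideanSpace ℝ (Fin k) =>
      p.1 / √(p.1 ^ 2 + ‖p.2‖ ^ 2)) (by fun_prop) hB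
  have h1 : volume {y : EuclideanSpace ℝ (Fin (k + 1)) | y ≠ 0 ∧ ‖y‖ < 1 ∧ y 0 / ‖y‖ ∈ B} =
      volume (spl ⁻¹' S) := by
    apply measure_congr
    have h0 : ∀ᵐ y : EuclideanSpace ℝ (Fin (k + 1)), y ≠ 0 := by
      simp [ae_iff]
    filter_upwards [h0] with y hy
    apply propext
    change (y ≠ 0 ∧ ‖y‖ < 1 ∧ y 0 / ‖y‖ ∈ B) ↔ ((spl y).1 ^ 2 + ‖(spl y).2‖ ^ 2 < 1 ∧
      (spl y).1 / √((spl y).1 ^ 2 + ‖(spl y).2‖ ^ 2) ∈ B)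
    rw [← norm_sq_spl, Real.sqrt_sq (norm_nonneg _), sq_lt_one_iff₀ (norm_nonneg _)]
    simp [hy, spl]
  rw [h1, measurePreserving_spl.measure_preimage hS.nullMeasurableSet, Measure.volume_eq_prod,
    Measure.prod_apply hS]
  have h2 : ∀ s : ℝ, volume (Prod.mk s ⁻¹' S) =
      ENNReal.ofReal (2 * Real.pi ^ ((k : ℝ) / 2) / Real.Gamma ((k : ℝ) / 2)) *
      ∫⁻ ρ in Set.Ioi (0:ℝ), ENNReal.ofReal (ρ ^ (k - 1)) *
      (if s ^ 2 + ρ ^ 2 < 1 then B.indicator 1 (s / √(s ^ 2 + ρ ^ 2)) else 0) := by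
    intro s
    rw [← area_eq hk, ← lintegral_radial hk, ← lintegral_indicator_one]
    · refine lintegral_congr fun z => ?_
      have : z ∈ Prod.mk s ⁻¹' S ↔ (s ^ 2 + ‖z‖ ^ 2 < 1 ∧ s / √(s ^ 2 + ‖z‖ ^ 2) ∈ B) := Iff.rfl
      by_cases hz1 : s ^ 2 + ‖z‖ ^ 2 < 1
      · by_cases hz2 : s / √(s ^ 2 + ‖z‖ ^ 2) ∈ B
        · rw [Set.indicator_of_mem (this.2 ⟨hz1, hz2⟩), if_pos hz1, Set.indicator_of_mem hz2]
          rfl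
        · rw [Set.indicator_of_notMem (fun h => hz2 (this.1 h).2), if_pos hz1,
            Set.indicator_of_notMem hz2]
      · rw [Set.indicator_of_notMem (fun h => hz1 (this.1 h).1), if_neg hz1]
    · exact measurable_prodMk_left hS
    · refine Measurable.ite (measurableSet_lt (by fun_prop) measurable_const) ?_ measurable_const
      exact (measurable_one.indicator hB).comp (by fun_prop)
  simp only [h2]
  rw [lintegral_const_mul' _ _ ENNReal.ofReal_ne_top, polar_half _ _ (measurable_one.indicator hB)]
  have hk1 : ((k - 1 : ℕ) : ℝ) = k - 1 := by push_cast [hk]; ring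
  rw [hk1]
  congr 3
  · ring
  · congr 1
    funext t
    congr 4
    ring

lemma exists_isometry_map {m : ℕ} (v w : EuclideanSpace ℝ (Fin m)) (h : ‖v‖ = ‖w‖) :
    ∃ g : EuclideanSpace ℝ (Fin m) ≃ₗᵢ[ℝ] EuclideanSpace ℝ (Fin m), g v = w ∧
      ∀ u, inner ℝ u v = inner ℝ u w → g u = u := by
  refine ⟨Submodule.reflection (Submodule.span ℝ {v - w})ᗮ, Submodule.reflection_sub h, ?_⟩
  intro u hu
  apply Submodule.reflection_mem_subspace_eq_self
  rw [Submodule.mem_orthogonal_singleton_iff_inner_left, inner_sub_right, hu, sub_self]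

/-- The weighted measure on `[-1,1]`. -/
def wMeas (m : ℕ) : Measure ℝ :=
  (volume.restrict (Set.Icc (-1 : ℝ) 1)).withDensity
                fun t => ENNReal.ofReal ((1 - t ^ 2) ^ (((m : ℝ) - 3) / 2))

/-- The area of `S^{m-2}`. -/
def cArea (m : ℕ) : ℝ := 2 * Real.pi ^ (((m : ℝ) - 1) / 2) / Real.Gamma (((m : ℝ) - 1) / 2)

lemma cArea_pos {m : ℕ} (hm : 2 ≤ m) : 0 < cArea m := by
  have : (2:ℝ) ≤ m := by exact_mod_cast hm
  have hG : 0 < Real.Gamma (((m : ℝ) - 1) / 2) := Real.Gamma_pos_of_pos (by linarith)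
  have := Real.pi_pos
  unfold cArea
  positivity

lemma map_inner_toSphere {m : ℕ} (hm : 2 ≤ m) (a : EuclideanSpace ℝ (Fin m)) (ha : ‖a‖ = 1) :
    Measure.map (fun x : Metric.sphere (0 : EuclideanSpace ℝ (Fin m)) 1 =>
        (inner ℝ (x : EuclideanSpace ℝ (Fin m)) a : ℝ))
      (volume : Measure (EuclideanSpace ℝ (Fin m))).toSphere =
      ENNReal.ofReal (cArea m) • wMeas m := by
  obtain ⟨k, rfl⟩ : ∃ k, m = k + 1 := ⟨m - 1, by omega⟩
  have hk : 1 ≤ k := by omega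
  have hmeas : Measurable (fun x : Metric.sphere (0 : EuclideanSpace ℝ (Fin (k+1))) 1 =>
        (inner ℝ (x : EuclideanSpace ℝ (Fin (k+1))) a : ℝ)) := by
    apply Continuous.measurable
    fun_prop
  obtain ⟨g, hg, -⟩ := exists_isometry_map a (EuclideanSpace.single 0 (1:ℝ)) (by simp [ha])
  ext B hB
  rw [Measure.map_apply hmeas hB, Measure.toSphere_apply' _ (hmeas hB),
    toSphere_preimage {y | inner ℝ y a ∈ B} ((fun x : Metric.sphere (0 : EuclideanSpace ℝ (Fin (k+1))) 1 =>
        (inner ℝ (x : EuclideanSpace ℝ (Fin (k+1))) a : ℝ)) ⁻¹' B) (fun x => Iff.rfl)]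
  have h1 : {y : EuclideanSpace ℝ (Fin (k+1)) | y ≠ 0 ∧ ‖y‖ < 1 ∧ ‖y‖⁻¹ • y ∈ {y | inner ℝ y a ∈ B}} =
      g.toMeasurableEquiv ⁻¹' {y | y ≠ 0 ∧ ‖y‖ < 1 ∧ y 0 / ‖y‖ ∈ B} := by
    ext y
    have : (g y) 0 = inner ℝ y a := by
      rw [← g.inner_map_map, hg, EuclideanSpace.inner_single_right]
      simp
    simp [this, inner_smul_left, div_eq_inv_mul]
  rw [h1, g.measurePreserving.measure_preimage_equiv (f := g.toMeasurableEquiv), volume_cone hk B hB,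
    Measure.smul_apply, wMeas, withDensity_apply _ hB, ← lintegral_indicator hB]
  have hc : cArea (k + 1) = 2 * Real.pi ^ ((k : ℝ) / 2) / Real.Gamma ((k : ℝ) / 2) := by
    simp [cArea]
  rw [hc, smul_eq_mul, mul_left_comm]
  congr 1
  rw [← mul_assoc, finrank_euclideanSpace, Fintype.card_fin, ← ENNReal.ofReal_natCast,
    ← ENNReal.ofReal_mul (by positivity)]
  have h3 : ((k + 1 : ℕ) : ℝ) * (1 / ((k : ℝ) + 1)) = 1 := by
    push_cast; field_simp
  rw [h3, ENNReal.ofReal_one, one_mul]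
  refine lintegral_congr fun t => ?_
  simp only [Set.indicator]
  split_ifs
  · simp only [Pi.one_apply, mul_one]
    congr 2
    push_cast; ring
  · simp

lemma eLpNorm_zonal {m : ℕ} (hm : 2 ≤ m) (a : EuclideanSpace ℝ (Fin m)) (ha : ‖a‖ = 1)
    (p : ℝ≥0∞) (Q : Polynomial ℂ) :
    eLpNorm (fun x : Metric.sphere (0 : EuclideanSpace ℝ (Fin m)) 1 =>
        Q.eval (((inner ℝ (x : EuclideanSpace ℝ (Fin m)) a : ℝ)) : ℂ)) p
      (volume : Measure (EuclideanSpace ℝ (Fin m))).toSphere =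
    ENNReal.ofReal (cArea m) ^ (1 / p).toReal *
      eLpNorm (fun t : ℝ => Q.eval (t : ℂ)) p (wMeas m) := by
  have hc : ENNReal.ofReal (cArea m) ≠ 0 := by simpa using cArea_pos hm
  rw [← smul_eq_mul, ← eLpNorm_smul_measure_of_ne_zero hc, ← map_inner_toSphere hm a ha,
    eLpNorm_map_measure]
  · rfl
  · apply Continuous.aestronglyMeasurable
    exact Q.continuous.comp Complex.continuous_ofReal
  · apply Continuous.aemeasurable
    fun_prop

lemma exists_min_invariant {V H B : Type*} [AddCommGroup V] [Module ℂ V] [FiniteDimensional ℂ V]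
    [NormedAddCommGroup H] [InnerProductSpace ℂ H] [NormedAddCommGroup B] [NormedSpace ℂ B]
    (T : V →ₗ[ℂ] H) (hT : Function.Injective T) (S : V →ₗ[ℂ] B) (L : V →ₗ[ℂ] ℂ) (P : V) :
    ∃ R : V, L R = L P ∧ ‖S R‖ ≤ ‖S P‖ ∧ ∀ g : V → V, (∀ v, ‖T (g v)‖ = ‖T v‖) →
      (∀ v, ‖S (g v)‖ = ‖S v‖) → (∀ v, L (g v) = L v) → g R = R := by
  let e : V ≃ₗ[ℂ] LinearMap.range T := LinearEquiv.ofInjective T hT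
  have : ProperSpace (LinearMap.range T) := FiniteDimensional.proper ℂ _
  let K : Set (LinearMap.range T) := {w | L (e.symm w) = L P ∧ ‖S (e.symm w)‖ ≤ ‖S P‖}
  have hc1 : Continuous fun w => L (e.symm w) :=
    (L ∘ₗ e.symm.toLinearMap).continuous_of_finiteDimensional
  have hc2 : Continuous fun w => S (e.symm w) :=
    (S ∘ₗ e.symm.toLinearMap).continuous_of_finiteDimensional
  have hK : IsClosed K := by
    refine IsClosed.inter ?_ ?_
    · exact isClosed_eq hc1 continuous_const
    · exact isClosed_le hc2.norm continuous_const
  have hne : K.Nonempty := ⟨e P, by simp [K]⟩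
  obtain ⟨w, hwK, hw⟩ := hK.exists_infDist_eq_dist hne 0
  have hmin : ∀ v, L v = L P → ‖S v‖ ≤ ‖S P‖ → ‖T (e.symm w)‖ ≤ ‖T v‖ := by
    intro v h1 h2
    have h3 : e v ∈ K := by simp [K, h1, h2]
    have h4 := Metric.infDist_le_dist_of_mem (x := 0) h3
    rw [hw, dist_zero_left, dist_zero_left] at h4
    have h5 : T (e.symm w) = ((e (e.symm w) : LinearMap.range T) : H) := rfl
    rw [h5, e.apply_symm_apply]
    exact h4
  set R := e.symm w with hR
  refine ⟨R, hwK.1, hwK.2, fun g h1 h2 h3 => ?_⟩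
  have h4 := hmin ((2⁻¹ : ℂ) • (R + g R)) (by
      rw [map_smul, map_add, h3, hwK.1, smul_eq_mul]; ring) (by
      rw [map_smul, norm_smul, map_add]
      have := norm_add_le (S R) (S (g R))
      rw [h2] at this
      have h5 : ‖S R‖ ≤ ‖S P‖ := hwK.2
      have h6 : ‖(2⁻¹:ℂ)‖ = 2⁻¹ := by simp
      rw [h6]
      linarith)
  rw [map_smul, norm_smul, map_add] at h4
  have h6 : ‖(2⁻¹:ℂ)‖ = 2⁻¹ := by simp
  rw [h6] at h4
  have h7 := parallelogram_law_with_norm ℂ (T R) (T (g R))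
  rw [h1] at h7
  have h8 : ‖T R - T (g R)‖ = 0 := by
    have := norm_nonneg (T R)
    nlinarith [norm_nonneg (T R - T (g R)), norm_nonneg (T R + T (g R))]
  rw [norm_sub_eq_zero_iff] at h8
  exact (hT h8).symm

lemma continuous_mvEval {m : ℕ} (P : MvPolynomial (Fin m) ℂ) : Continuous (mvEval P) := by
  unfold mvEval
  exact (MvPolynomial.continuous_eval P).comp (by fun_prop)

lemma totalDegree_lf_le {m : ℕ} (v : EuclideanSpace ℝ (Fin m)) : (lf v).totalDegree ≤ 1 := by
  refine MvPolynomial.totalDegree_finsetSum_le fun j _ => ?_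
  refine (MvPolynomial.totalDegree_mul _ _).trans ?_
  simp

lemma totalDegree_pComp_le {m : ℕ}
    (g : EuclideanSpace ℝ (Fin m) ≃ₗᵢ[ℝ] EuclideanSpace ℝ (Fin m))
    (P : MvPolynomial (Fin m) ℂ) : (pComp g P).totalDegree ≤ P.totalDegree := by
  rw [pComp, MvPolynomial.aeval_def, MvPolynomial.eval₂_eq]
  refine MvPolynomial.totalDegree_finsetSum_le fun d hd => ?_
  refine (MvPolynomial.totalDegree_mul _ _).trans ?_
  refine le_trans ?_ (MvPolynomial.le_totalDegree hd)
  rw [MvPolynomial.algebraMap_eq, MvPolynomial.totalDegree_C, zero_add]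
  refine (MvPolynomial.totalDegree_finsetProd _ _).trans ?_
  rw [Finsupp.sum]
  refine Finset.sum_le_sum fun i _ => ?_
  refine (MvPolynomial.totalDegree_pow _ _).trans ?_
  simpa using Nat.mul_le_mul_left (d i) (totalDegree_lf_le _)

lemma totalDegree_aeval_lf_le {m : ℕ} (v : EuclideanSpace ℝ (Fin m)) (Q : Polynomial ℂ) :
    (Polynomial.aeval (lf v) Q).totalDegree ≤ Q.natDegree := by
  rw [Polynomial.aeval_eq_sum_range]
  refine MvPolynomial.totalDegree_finsetSum_le fun i hi => ?_
  refine (MvPolynomial.totalDegree_smul_le _ _).trans ?_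
  refine (MvPolynomial.totalDegree_pow _ _).trans ?_
  have := Nat.mul_le_mul_left i (totalDegree_lf_le v)
  have := Finset.mem_range.1 hi
  omega

lemma mvEval_aeval_lf {m : ℕ} (v x : EuclideanSpace ℝ (Fin m)) (Q : Polynomial ℂ) :
    mvEval (Polynomial.aeval (lf v) Q) x = Q.eval ((inner ℝ x v : ℝ) : ℂ) := by
  rw [← mvEval_lf, mvEval, mvEval, Polynomial.aeval_def, Polynomial.hom_eval₂, Polynomial.eval,
    MvPolynomial.algebraMap_eq]
  congr 1
  ext c
  simp

/-- A polynomial vanishing on the unit ball is zero. -/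
lemma eq_zero_of_ball {m : ℕ} (P : MvPolynomial (Fin m) ℂ)
    (h : ∀ x : EuclideanSpace ℝ (Fin m), ‖x‖ < 1 → mvEval P x = 0) : P = 0 := by
  set ε : ℝ := 1 / (m + 1)
  have hε : 0 < ε := by positivity
  refine MvPolynomial.funext_set (fun _ => (fun t : ℝ => (t : ℂ)) '' Set.Ioo 0 ε) (fun i => ?_)
    fun z hz => ?_
  · exact (Set.Ioo_infinite hε).image Complex.ofReal_injective.injOn
  · choose t ht htz using fun i => hz i (Set.mem_univ i)
    have := h (WithLp.toLp 2 t) ?_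
    · rw [map_zero, ← this, mvEval]
      congr 1
      congr 1
      ext i
      exact (htz i).symm
    · have h1 : ‖(WithLp.toLp 2 t : EuclideanSpace ℝ (Fin m))‖ ≤ ∑ i, ‖t i‖ := by
        rw [← sq_le_sq₀ (norm_nonneg _) (by positivity), EuclideanSpace.norm_sq_eq]
        exact Finset.sum_sq_le_sq_sum_of_nonneg fun i _ => norm_nonneg _
      refine h1.trans_lt ?_
      have h2 : ∑ i, ‖t i‖ ≤ ∑ i : Fin m, ε := Finset.sum_le_sum fun i _ => by
        rw [Real.norm_of_nonneg (ht i).1.le]; exact (ht i).2.le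
      refine h2.trans_lt ?_
      simp only [Finset.sum_const, Finset.card_univ, Fintype.card_fin, nsmul_eq_mul, ε]
      rw [mul_one_div, div_lt_one (by positivity)]
      linarith

/-- Polynomials as elements of `L^p`, on a finite measure. -/
def toLpMap {m : ℕ} {X : Type*} [MeasurableSpace X] (μ : Measure X) (p : ℝ≥0∞)
    (ι : X → EuclideanSpace ℝ (Fin m)) (h : ∀ P : MvPolynomial (Fin m) ℂ, MemLp (fun x => mvEval P (ι x)) p μ) :
    MvPolynomial (Fin m) ℂ →ₗ[ℂ] Lp ℂ p μ where
  toFun P := (h P).toLp _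
  map_add' P Q := by
    rw [← MemLp.toLp_add]
    exact MemLp.toLp_congr _ _ (ae_of_all _ fun x => by simp [mvEval])
  map_smul' c P := by
    rw [RingHom.id_apply, ← MemLp.toLp_const_smul]
    exact MemLp.toLp_congr _ _ (ae_of_all _ fun x => by simp [mvEval])


/-- `f` restricted to the circle is `Q₁(t) + s Q₂(t)` with degree bounds. -/
def GoodC (d : ℕ) (f : ℝ → ℝ → ℂ) : Prop :=
  ∃ Q₁ ∈ Polynomial.degreeLT ℂ (d + 1), ∃ Q₂ ∈ Polynomial.degreeLT ℂ d,
    ∀ t s : ℝ, t ^ 2 + s ^ 2 = 1 → f t s = Q₁.eval (t : ℂ) + s * Q₂.eval (t : ℂ)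

lemma X_mul_mem_degreeLT {d : ℕ} {Q : Polynomial ℂ} (h : Q ∈ Polynomial.degreeLT ℂ d) :
    X * Q ∈ Polynomial.degreeLT ℂ (d + 1) := by
  rw [Polynomial.mem_degreeLT, Polynomial.degree_lt_iff_coeff_zero] at *
  intro k hk
  obtain ⟨j, rfl⟩ : ∃ j, k = j + 1 := ⟨k - 1, by omega⟩
  rw [Polynomial.coeff_X_mul]
  exact h j (by omega)

lemma GoodC.mono {d d' : ℕ} {f : ℝ → ℝ → ℂ} (h : GoodC d f) (hd : d ≤ d') : GoodC d' f := by
  obtain ⟨Q₁, h1, Q₂, h2, h⟩ := h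
  exact ⟨Q₁, Polynomial.degreeLT_mono (by omega) h1, Q₂, Polynomial.degreeLT_mono hd h2, h⟩

lemma GoodC.zero (d : ℕ) : GoodC d (fun _ _ => 0) :=
  ⟨0, zero_mem _, 0, zero_mem _, by simp⟩

lemma GoodC.add {d : ℕ} {f g : ℝ → ℝ → ℂ} (hf : GoodC d f) (hg : GoodC d g) :
    GoodC d (fun t s => f t s + g t s) := by
  obtain ⟨Q₁, h1, Q₂, h2, h⟩ := hf
  obtain ⟨Q₁', h1', Q₂', h2', h'⟩ := hg
  refine ⟨Q₁ + Q₁', add_mem h1 h1', Q₂ + Q₂', add_mem h2 h2', fun t s hts => ?_⟩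
  simp only [h t s hts, h' t s hts, Polynomial.eval_add]
  ring

lemma GoodC.mul_lin {d : ℕ} {f : ℝ → ℝ → ℂ} (hf : GoodC d f) (α β : ℂ) :
    GoodC (d + 1) (fun t s => f t s * (α * t + β * s)) := by
  obtain ⟨Q₁, h1, Q₂, h2, h⟩ := hf
  refine ⟨α • (X * Q₁) + β • (Q₂ - X * (X * Q₂)), ?_, α • (X * Q₂) + β • Q₁, ?_, ?_⟩
  · refine add_mem (Submodule.smul_mem _ _ (X_mul_mem_degreeLT h1)) (Submodule.smul_mem _ _ ?_)
    exact sub_mem (Polynomial.degreeLT_mono (by omega) h2)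
      (X_mul_mem_degreeLT (X_mul_mem_degreeLT h2))
  · exact add_mem (Submodule.smul_mem _ _ (X_mul_mem_degreeLT h2)) (Submodule.smul_mem _ _ h1)
  · intro t s hts
    have h3 : (t : ℂ) ^ 2 + (s : ℂ) ^ 2 = 1 := by exact_mod_cast hts
    simp only [h t s hts, Polynomial.eval_add, Polynomial.eval_smul, Polynomial.eval_sub,
      Polynomial.eval_mul, Polynomial.eval_X, smul_eq_mul]
    linear_combination (β * Q₂.eval (t : ℂ)) * h3

lemma goodC_mvEval {m : ℕ} (a e : EuclideanSpace ℝ (Fin m)) (P : MvPolynomial (Fin m) ℂ) :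
    GoodC P.totalDegree (fun t s => mvEval P (t • a + s • e)) := by
  have hmon : ∀ d c, GoodC (MvPolynomial.monomial d c : MvPolynomial (Fin m) ℂ).totalDegree
      (fun t s => mvEval (MvPolynomial.monomial d c) (t • a + s • e)) := by
    intro d c
    refine MvPolynomial.induction_on_monomial
      (motive := fun p => GoodC p.totalDegree (fun t s => mvEval p (t • a + s • e))) ?_ ?_ d c
    · intro c
      refine ⟨C c, ?_, 0, zero_mem _, by simp [mvEval]⟩
      rw [Polynomial.mem_degreeLT]
      refine (Polynomial.degree_C_le).trans_lt ?_
      exact_mod_cast Nat.succ_pos _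
    · intro p i hp
      by_cases h0 : p = 0
      · subst h0
        simpa [mvEval] using GoodC.zero _
      · rw [MvPolynomial.totalDegree_mul_of_isDomain h0 (MvPolynomial.X_ne_zero i),
          MvPolynomial.totalDegree_X]
        have := hp.mul_lin ((a i : ℝ) : ℂ) ((e i : ℝ) : ℂ)
        convert this using 3 with t s
        rw [mvEval, mvEval, map_mul, MvPolynomial.eval_X]
        congr 1
        simp
        ring
  have key : ∀ S : Finset (Fin m →₀ ℕ), S ⊆ P.support → GoodC P.totalDegree (fun t s =>
      mvEval (∑ v ∈ S, MvPolynomial.monomial v (MvPolynomial.coeff v P)) (t • a + s • e)) := by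
    intro S
    induction S using Finset.induction_on with
    | empty => intro _; simpa [mvEval] using GoodC.zero _
    | insert v S hv ih =>
      intro hS
      have h1 := ih ((Finset.subset_insert _ _).trans hS)
      have hv' : v ∈ P.support := hS (Finset.mem_insert_self _ _)
      have h2 := (hmon v (MvPolynomial.coeff v P)).mono (d' := P.totalDegree) (by
        rw [MvPolynomial.totalDegree_monomial _ (MvPolynomial.mem_support_iff.1 hv')]
        exact MvPolynomial.le_totalDegree hv')
      convert h2.add h1 using 3 with t s
      rw [Finset.sum_insert hv]
      simp [mvEval]
  have := key P.support le_rfl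
  rwa [MvPolynomial.support_sum_monomial_coeff] at this

lemma exists_unit_orthogonal {m : ℕ} (hm : 2 ≤ m) (a : EuclideanSpace ℝ (Fin m)) :
    ∃ e : EuclideanSpace ℝ (Fin m), ‖e‖ = 1 ∧ inner ℝ a e = 0 := by
  have h : (Submodule.span ℝ {a})ᗮ ≠ ⊥ := by
    intro h
    rw [Submodule.orthogonal_eq_bot_iff] at h
    have h1 := finrank_span_le_card (R := ℝ) ({a} : Set (EuclideanSpace ℝ (Fin m)))
    rw [h, finrank_top, finrank_euclideanSpace_fin] at h1
    simp at h1
    omega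
  obtain ⟨v, hv, hv0⟩ := Submodule.exists_mem_ne_zero_of_ne_bot h
  rw [Submodule.mem_orthogonal_singleton_iff_inner_right] at hv
  refine ⟨‖v‖⁻¹ • v, ?_, ?_⟩
  · rw [norm_smul, norm_inv, norm_norm, inv_mul_cancel₀ (norm_ne_zero_iff.2 hv0)]
  · rw [inner_smul_right, hv, mul_zero]

/-- An invariant polynomial is zonal on the sphere. -/
lemma exists_zonal {m n : ℕ} (hm : 2 ≤ m) (a : EuclideanSpace ℝ (Fin m)) (ha : ‖a‖ = 1)
    (R : MvPolynomial (Fin m) ℂ) (hR : R.totalDegree ≤ n)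
    (hinv : ∀ g : EuclideanSpace ℝ (Fin m) ≃ₗᵢ[ℝ] EuclideanSpace ℝ (Fin m), g a = a →
      pComp g R = R) :
    ∃ Q : Polynomial ℂ, Q.natDegree ≤ n ∧
      ∀ x : EuclideanSpace ℝ (Fin m), ‖x‖ = 1 → mvEval R x = Q.eval ((inner ℝ x a : ℝ) : ℂ) := by
  obtain ⟨e, he, hae⟩ := exists_unit_orthogonal hm a
  have hz : ∀ x y : EuclideanSpace ℝ (Fin m), ‖x‖ = 1 → ‖y‖ = 1 → inner ℝ a x = inner ℝ a y →
      mvEval R x = mvEval R y := by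
    intro x y hx hy hxy
    obtain ⟨g, hg, hg2⟩ := exists_isometry_map x y (hx.trans hy.symm)
    rw [← hg, ← mvEval_pComp, hinv g (hg2 a hxy)]
  obtain ⟨Q₁, h1, Q₂, h2, h⟩ := (goodC_mvEval a e R).mono hR
  simp only at h
  refine ⟨Q₁, ?_, ?_⟩
  · rw [Polynomial.mem_degreeLT] at h1
    rw [Polynomial.natDegree_le_iff_coeff_eq_zero]
    rw [Polynomial.degree_lt_iff_coeff_zero] at h1
    exact fun k hk => h1 k hk
  intro x hx
  set t := inner ℝ x a
  set s := √(1 - t ^ 2)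
  have ht : t ^ 2 ≤ 1 := by
    have := abs_real_inner_le_norm x a
    rw [hx, ha, mul_one] at this
    exact (sq_le_one_iff_abs_le_one _).2 this
  have hts : t ^ 2 + s ^ 2 = 1 := by
    rw [Real.sq_sqrt (by linarith)]; ring
  have hn : ∀ r : ℝ, t ^ 2 + r ^ 2 = 1 → ‖t • a + r • e‖ = 1 := by
    intro r hr
    rw [← sq_eq_sq₀ (norm_nonneg _) zero_le_one, norm_add_sq_real, norm_smul, norm_smul,
      inner_smul_left, inner_smul_right, hae, ha, he]
    simp [hr]
  have hi : ∀ r : ℝ, inner ℝ a (t • a + r • e) = t := by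
    intro r
    rw [inner_add_right, inner_smul_right, inner_smul_right, hae, real_inner_self_eq_norm_sq, ha]
    simp
  have hts' : t ^ 2 + (-s) ^ 2 = 1 := by rw [neg_sq]; exact hts
  have e1 := hz x (t • a + s • e) hx (hn s hts) (by rw [hi, real_inner_comm])
  have e2 := hz x (t • a + (-s) • e) hx (hn _ hts') (by rw [hi, real_inner_comm])
  rw [h t s hts] at e1
  rw [h t (-s) hts'] at e2
  push_cast at e2
  linear_combination (e1 + e2) / 2


lemma memLp_sphere {m : ℕ} (p : ℝ≥0∞) (P : MvPolynomial (Fin m) ℂ) :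
    MemLp (fun x : Metric.sphere (0 : EuclideanSpace ℝ (Fin m)) 1 =>
      mvEval P (x : EuclideanSpace ℝ (Fin m))) p
      (volume : Measure (EuclideanSpace ℝ (Fin m))).toSphere := by
  have hc := continuous_mvEval P
  obtain ⟨c, hc'⟩ := (isCompact_sphere (0 : EuclideanSpace ℝ (Fin m)) 1).exists_bound_of_continuousOn
    hc.continuousOn
  exact MemLp.of_bound (hc.comp continuous_subtype_val).aestronglyMeasurable c
    (ae_of_all _ fun x => hc' x x.2)

lemma memLp_ball {m : ℕ} (p : ℝ≥0∞) (P : MvPolynomial (Fin m) ℂ) :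
    MemLp (fun x : EuclideanSpace ℝ (Fin m) => mvEval P (id x)) p
      (volume.restrict (Metric.ball 0 1)) := by
  have hc := continuous_mvEval P
  have : IsFiniteMeasure
      ((volume : Measure (EuclideanSpace ℝ (Fin m))).restrict (Metric.ball 0 1)) :=
    ⟨by simpa using measure_ball_lt_top⟩
  obtain ⟨c, hc'⟩ := (isCompact_closedBall (0 : EuclideanSpace ℝ (Fin m)) 1).exists_bound_of_continuousOn
    hc.continuousOn
  refine MemLp.of_bound hc.aestronglyMeasurable c ?_
  filter_upwards [ae_restrict_mem measurableSet_ball] with x hx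
  exact hc' x (Metric.ball_subset_closedBall hx)

lemma measurePreserving_ball {m : ℕ}
    (g : EuclideanSpace ℝ (Fin m) ≃ₗᵢ[ℝ] EuclideanSpace ℝ (Fin m)) :
    MeasurePreserving g (volume.restrict (Metric.ball (0 : EuclideanSpace ℝ (Fin m)) 1))
      (volume.restrict (Metric.ball (0 : EuclideanSpace ℝ (Fin m)) 1)) := by
  have h := g.measurePreserving.restrict_preimage
    (measurableSet_ball (x := (0 : EuclideanSpace ℝ (Fin m))) (ε := 1))
  have h2 : g ⁻¹' Metric.ball (0 : EuclideanSpace ℝ (Fin m)) 1 = Metric.ball 0 1 := by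
    ext x
    simp
  rwa [h2] at h

lemma exists_invariant {m n : ℕ} (N : ℕ) (p : ℝ≥0∞) (hp : 1 ≤ p)
    (a : EuclideanSpace ℝ (Fin m)) (P : MvPolynomial (Fin m) ℂ) (hP : P.totalDegree ≤ n) :
    ∃ R : MvPolynomial (Fin m) ℂ, R.totalDegree ≤ n ∧
      mvEval ((pD m)^[N] R) a = mvEval ((pD m)^[N] P) a ∧
      eLpNorm (fun x : Metric.sphere (0 : EuclideanSpace ℝ (Fin m)) 1 => mvEval R x) p
            (volume : Measure (EuclideanSpace ℝ (Fin m))).toSphere ≤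
      eLpNorm (fun x : Metric.sphere (0 : EuclideanSpace ℝ (Fin m)) 1 => mvEval P x) p
            (volume : Measure (EuclideanSpace ℝ (Fin m))).toSphere ∧
      ∀ g : EuclideanSpace ℝ (Fin m) ≃ₗᵢ[ℝ] EuclideanSpace ℝ (Fin m), g a = a →
        pComp g R = R := by
  have : Fact (1 ≤ p) := ⟨hp⟩
  let V := MvPolynomial.restrictTotalDegree (Fin m) ℂ n
  let T₀ := toLpMap (m := m) (volume.restrict (Metric.ball 0 1)) 2 id (memLp_ball 2)
  let S₀ := toLpMap (m := m) (volume : Measure (EuclideanSpace ℝ (Fin m))).toSphere p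
    (fun x : Metric.sphere (0 : EuclideanSpace ℝ (Fin m)) 1 => (x : EuclideanSpace ℝ (Fin m)))
    (memLp_sphere p)
  let ev : MvPolynomial (Fin m) ℂ →ₗ[ℂ] ℂ :=
    (MvPolynomial.aeval (fun j => ((a j : ℝ) : ℂ))).toLinearMap
  let L₀ : MvPolynomial (Fin m) ℂ →ₗ[ℂ] ℂ := ev ∘ₗ (pD m ^ N)
  have hL₀ : ∀ P, L₀ P = mvEval ((pD m)^[N] P) a := by
    intro P
    simp only [L₀, ev, mvEval, LinearMap.comp_apply, Module.End.pow_apply, AlgHom.toLinearMap_apply]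
    rfl
  have hT : Function.Injective (T₀ ∘ₗ V.subtype) := by
    rw [injective_iff_map_eq_zero]
    intro v hv
    have h1 : (fun x => mvEval v.1 (id x)) =ᵐ[volume.restrict (Metric.ball 0 1)] 0 :=
      (MemLp.toLp_eq_toLp_iff (memLp_ball 2 v.1) MemLp.zero).1 (hv.trans (MemLp.toLp_zero _).symm)
    have h2 := Measure.eqOn_open_of_ae_eq h1 Metric.isOpen_ball
      (continuous_mvEval v.1).continuousOn continuousOn_const
    have h3 : v.1 = 0 := eq_zero_of_ball _ fun x hx => h2 (by simpa using hx)
    exact Subtype.ext h3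
  obtain ⟨R, hR1, hR2, hR3⟩ := exists_min_invariant (T₀ ∘ₗ V.subtype) hT (S₀ ∘ₗ V.subtype)
    (L₀ ∘ₗ V.subtype) ⟨P, (MvPolynomial.mem_restrictTotalDegree _ _ _).2 hP⟩
  refine ⟨R.1, (MvPolynomial.mem_restrictTotalDegree _ _ _).1 R.2, ?_, ?_, ?_⟩
  · simpa [hL₀] using hR1
  · have : ‖(memLp_sphere p R.1).toLp‖ ≤ ‖(memLp_sphere p P).toLp‖ := hR2
    rw [Lp.norm_toLp, Lp.norm_toLp] at this
    exact (ENNReal.toReal_le_toReal (memLp_sphere p R.1).2.ne (memLp_sphere p P).2.ne).1 this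
  · intro g hg
    have hV : ∀ v : V, pComp g v.1 ∈ V := fun v =>
      (MvPolynomial.mem_restrictTotalDegree _ _ _).2
        ((totalDegree_pComp_le g v.1).trans ((MvPolynomial.mem_restrictTotalDegree _ _ _).1 v.2))
    have := hR3 (fun v => ⟨pComp g v.1, hV v⟩) ?_ ?_ ?_
    · exact congrArg Subtype.val this
    · intro v
      change ‖(memLp_ball 2 (pComp g v.1)).toLp‖ = ‖(memLp_ball 2 v.1).toLp‖
      rw [Lp.norm_toLp, Lp.norm_toLp,
        ← eLpNorm_comp_measurePreserving (memLp_ball 2 v.1).1 (measurePreserving_ball g)]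
      congr 2
      ext x
      exact mvEval_pComp g v.1 x
    · intro v
      change ‖(memLp_sphere p (pComp g v.1)).toLp‖ = ‖(memLp_sphere p v.1).toLp‖
      rw [Lp.norm_toLp, Lp.norm_toLp,
        ← eLpNorm_comp_measurePreserving (memLp_sphere p v.1).1 (measurePreserving_sphMap g)]
      congr 2
      ext x
      exact mvEval_pComp g v.1 x
    · intro v
      change L₀ (pComp g v.1) = L₀ v.1
      rw [hL₀, hL₀, pD_iter_pComp, mvEval_pComp, hg]

lemma sphLap_iter_congr {m : ℕ} {f g : EuclideanSpace ℝ (Fin m) → ℂ} (N : ℕ)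
    (h : ∀ x, ‖x‖ = 1 → f x = g x) (x : EuclideanSpace ℝ (Fin m)) (hx : ‖x‖ = 1) :
    (sphLap (m := m))^[N] f x = (sphLap (m := m))^[N] g x := by
  induction N generalizing x with
  | zero => exact h x hx
  | succ N ih =>
    rw [Function.iterate_succ_apply', Function.iterate_succ_apply']
    exact sphLap_congr ih x hx

lemma const_eq {m : ℕ} (hm : 2 ≤ m) (p : ℝ≥0∞) :
    ENNReal.ofReal ((1 / cArea m) ^ (1 / p.toReal)) =
      (ENNReal.ofReal (cArea m) ^ (1 / p).toReal)⁻¹ := by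
  have h := cArea_pos hm
  rw [ENNReal.toReal_div, ENNReal.toReal_one, ENNReal.ofReal_rpow_of_pos h,
    ← ENNReal.ofReal_inv_of_pos (Real.rpow_pos_of_pos h _), one_div (cArea m), Real.inv_rpow h.le]

lemma sphLap_iter_zonal {m : ℕ} (N : ℕ)
    (a : EuclideanSpace ℝ (Fin m)) (ha : ‖a‖ = 1) (Q : Polynomial ℂ) :
    (sphLap (m := m))^[N] (mvEval (Polynomial.aeval (lf a) Q)) a =
      ((gegenOp ((m : ℝ) / 2 - 1))^[N] Q).eval 1 := by
  rw [sphLap_iter_mvEval _ _ _ ha, pD_iter_zonal _ ha, mvEval_aeval_lf,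
    real_inner_self_eq_norm_sq, ha]
  simp

lemma div_mul_aux (x c y : ℝ≥0∞) (h1 : c ≠ 0) (h2 : c ≠ ∞) : x / (c * y) = c⁻¹ * (x / y) := by
  rw [div_eq_mul_inv, div_eq_mul_inv, ENNReal.mul_inv (Or.inl h1) (Or.inl h2)]
  ring

lemma zonal_term {m : ℕ} (hm : 2 ≤ m) (N : ℕ) (p : ℝ≥0∞)
    (a : EuclideanSpace ℝ (Fin m)) (ha : ‖a‖ = 1) (Q : Polynomial ℂ) :
    (‖(sphLap (m := m))^[N] (mvEval (Polynomial.aeval (lf a) Q)) a‖₊ : ℝ≥0∞) /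
          eLpNorm (fun x : Metric.sphere (0 : EuclideanSpace ℝ (Fin m)) 1 =>
            mvEval (Polynomial.aeval (lf a) Q) x) p
            (volume : Measure (EuclideanSpace ℝ (Fin m))).toSphere =
    ENNReal.ofReal ((1 / cArea m) ^ (1 / p.toReal)) *
     ((‖((gegenOp ((m : ℝ) / 2 - 1))^[N] Q).eval 1‖₊ : ℝ≥0∞) /
            eLpNorm (fun t : ℝ => Q.eval (t : ℂ)) p (wMeas m)) := by
  rw [sphLap_iter_zonal N a ha, const_eq hm]
  simp only [mvEval_aeval_lf]
  rw [eLpNorm_zonal hm a ha]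
  have h0 : ENNReal.ofReal (cArea m) ≠ 0 := by simpa using cArea_pos hm
  have h1 : ENNReal.ofReal (cArea m) ^ (1 / p).toReal ≠ 0 := by
    simp [ENNReal.rpow_eq_zero_iff, h0]
  have h2 : ENNReal.ofReal (cArea m) ^ (1 / p).toReal ≠ ∞ :=
    ENNReal.rpow_ne_top_of_nonneg ENNReal.toReal_nonneg ENNReal.ofReal_ne_top
  exact div_mul_aux _ _ _ h1 h2

theorem main_aux
    {m n : ℕ} (hm : 2 ≤ m) (N : ℕ) (p : ℝ≥0∞) (hp : 1 ≤ p)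
    (a : EuclideanSpace ℝ (Fin m)) (ha : ‖a‖ = 1) :
    (⨆ (P : MvPolynomial (Fin m) ℂ) (_ : P.totalDegree ≤ n ∧ P ≠ 0),
        (‖(sphLap (m := m))^[N] (mvEval P) a‖₊ : ℝ≥0∞) /
          eLpNorm (fun x : Metric.sphere (0 : EuclideanSpace ℝ (Fin m)) 1 => mvEval P x) p
            (volume : Measure (EuclideanSpace ℝ (Fin m))).toSphere)
      = ENNReal.ofReal ((1 / cArea m) ^ (1 / p.toReal)) *
        ⨆ (Q : Polynomial ℂ) (_ : Q.natDegree ≤ n ∧ Q ≠ 0),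
          (‖((gegenOp ((m : ℝ) / 2 - 1))^[N] Q).eval 1‖₊ : ℝ≥0∞) /
            eLpNorm (fun t : ℝ => Q.eval (t : ℂ)) p (wMeas m) := by
  simp only [ENNReal.mul_iSup]
  apply le_antisymm
  · refine iSup₂_le fun P hP => ?_
    obtain ⟨R, hRd, hR1, hR2, hR3⟩ := exists_invariant N p hp a P hP.1
    obtain ⟨Q, hQd, hQ⟩ := exists_zonal hm a ha R hRd hR3
    have hRQ : ∀ x : EuclideanSpace ℝ (Fin m), ‖x‖ = 1 →
        mvEval R x = mvEval (Polynomial.aeval (lf a) Q) x := by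
      intro x hx
      rw [hQ x hx, mvEval_aeval_lf]
    have e1 : (sphLap (m := m))^[N] (mvEval P) a =
        (sphLap (m := m))^[N] (mvEval (Polynomial.aeval (lf a) Q)) a := by
      rw [← sphLap_iter_congr N hRQ a ha, sphLap_iter_mvEval _ _ _ ha, sphLap_iter_mvEval _ _ _ ha,
        hR1]
    have e2 : (fun x : Metric.sphere (0 : EuclideanSpace ℝ (Fin m)) 1 => mvEval R x) =
        fun x : Metric.sphere (0 : EuclideanSpace ℝ (Fin m)) 1 =>
          mvEval (Polynomial.aeval (lf a) Q) x := by
      ext x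
      exact hRQ x (by simp)
    rw [e2] at hR2
    rw [e1]
    refine (ENNReal.div_le_div_left hR2 _).trans ?_
    by_cases hQ0 : Q = 0
    · have : (sphLap (m := m))^[N] (mvEval (Polynomial.aeval (lf a) Q)) a = 0 := by
        rw [sphLap_iter_mvEval _ _ _ ha, hQ0, map_zero]
        have : (pD m)^[N] 0 = 0 := by rw [← Module.End.pow_apply, map_zero]
        rw [this]
        simp [mvEval]
      rw [this]
      simp
    · rw [zonal_term hm N p a ha]
      exact le_iSup₂_of_le Q ⟨hQd, hQ0⟩ le_rfl
  · refine iSup₂_le fun Q hQ => ?_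
    rw [← zonal_term hm N p a ha]
    refine le_iSup₂_of_le (Polynomial.aeval (lf a) Q)
      ⟨(totalDegree_aeval_lf_le a Q).trans hQ.1, fun h => hQ.2 ?_⟩ le_rfl
    refine Polynomial.eq_zero_of_infinite_isRoot Q ?_
    refine (Set.infinite_range_of_injective Complex.ofReal_injective).mono ?_
    rintro _ ⟨t, rfl⟩
    have := mvEval_aeval_lf a (t • a) Q
    rw [h, inner_smul_left, real_inner_self_eq_norm_sq, ha] at this
    simpa [mvEval, Polynomial.IsRoot] using this.symm

/-- **Corollary 2.15.**  For `m ≥ 2`, `N ≥ 0`, `p ∈ [1,∞]` and `a ∈ S^{m-1}`, the sharp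
constant in `|δ^N P(a)| ≤ C ‖P‖_{L_p(S^{m-1})}` over polynomials of degree at most `n`
in `m` variables equals `(1/|S^{m-2}|)^{1/p}` times the corresponding sharp constant
for univariate polynomials of degree at most `n` with the Gegenbauer operator
`(Ge_{m/2-1})^N` at the point `1`, in `L_p` on `[-1,1]` with weight
`(1-t²)^{(m-3)/2}`  (`1/∞ = 0`). -/
theorem sharp_constant_sphere_eq_univariate_gegenbauer
    {m n : ℕ} (hm : 2 ≤ m) (hn : 1 ≤ n) (N : ℕ) (p : ℝ≥0∞) (hp : 1 ≤ p)
    (a : EuclideanSpace ℝ (Fin m)) (ha : ‖a‖ = 1) :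
    (⨆ (P : MvPolynomial (Fin m) ℂ) (_ : P.totalDegree ≤ n ∧ P ≠ 0),
        (‖(sphLap (m := m))^[N] (mvEval P) a‖₊ : ℝ≥0∞) /
          eLpNorm (fun x : Metric.sphere (0 : EuclideanSpace ℝ (Fin m)) 1 => mvEval P x) p
            (volume : Measure (EuclideanSpace ℝ (Fin m))).toSphere)
      = ENNReal.ofReal
          ((1 / (2 * Real.pi ^ (((m : ℝ) - 1) / 2) / Real.Gamma (((m : ℝ) - 1) / 2)))
            ^ (1 / p.toReal)) *
        ⨆ (Q : Polynomial ℂ) (_ : Q.natDegree ≤ n ∧ Q ≠ 0),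
          (‖((gegenOp ((m : ℝ) / 2 - 1))^[N] Q).eval 1‖₊ : ℝ≥0∞) /
            eLpNorm (fun t : ℝ => Q.eval (t : ℂ)) p
              ((volume.restrict (Set.Icc (-1 : ℝ) 1)).withDensity
                fun t => ENNReal.ofReal ((1 - t ^ 2) ^ (((m : ℝ) - 3) / 2))) := by
  exact main_aux hm N p hp a ha
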